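/- There exist constants C, c > 0 such that for all integers b, n, m, x ≥ 1 and for i ∈ {0,1}, P_i( 𝔇_{β_{n+m}} − 𝔇_{β_n} ≥ b + x and 𝔇_{β_n} < −b ) ≤ C e^{−cx} · P_i( 𝔇_{β_{n+m}} − 𝔇_{β_n} ≥ b and 𝔇_{β_n} < −b ). -/

import Mathlib

open MeasureTheory Filter ProbabilityTheory

noncomputable section

/-- One-step transition probability of the urn discrepancy chain with parameter `lam`:
from state `i`, jump to `i+1` with probability `lam^(2i-1)/(1+lam^(2i-1))` and to `i-1`
with probability `1/(1+lam^(2i-1))`. -/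
def urnStep (lam : ℝ) (i j : ℤ) : ℝ :=
  if j = i + 1 then lam ^ (2 * i - 1) / (1 + lam ^ (2 * i - 1))
  else if j = i - 1 then 1 / (1 + lam ^ (2 * i - 1))
  else 0

/-- `P` is the family of laws (indexed by the starting point) of the urn discrepancy
chain with parameter `lam`, characterized by its cylinder probabilities. -/
def IsUrnChain (lam : ℝ) (P : ℤ → Measure (ℕ → ℤ)) : Prop :=
  (∀ x, IsProbabilityMeasure (P x)) ∧
    ∀ (x : ℤ) (n : ℕ) (p : ℕ → ℤ),
      (P x {ω | ∀ i ≤ n, ω i = p i}).toReal =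
        (if p 0 = x then (1 : ℝ) else 0) *
          ∏ i ∈ Finset.range n, urnStep lam (p i) (p (i + 1))

/-- Number of down-steps of the path `ω` during the time interval `[1, j]`. -/
def downCount (ω : ℕ → ℤ) (j : ℕ) : ℕ :=
  ((Finset.Icc 1 j).filter fun ℓ => ω ℓ = ω (ℓ - 1) - 1).card

/-- `betaTime ω i` is the time of the `i`-th down-step of the path `ω`. -/
def betaTime (ω : ℕ → ℤ) (i : ℕ) : ℕ :=
  sInf {j | 1 ≤ j ∧ downCount ω j = i}

/-- The probability distribution `π(x) = lam^(x²) / Σ_y lam^(y²)` on `ℤ`. -/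
def urnPi (lam : ℝ) (x : ℤ) : ℝ :=
  lam ^ (x ^ 2) / ∑' y : ℤ, lam ^ (y ^ 2)

/-- The down-step probability in terms of the positive power `lam ^ (1 - 2 * w)`. -/
theorem down_prob_eq {lam : ℝ} (h0 : 0 < lam) (w : ℤ) :
    1 / (1 + lam ^ (2 * w - 1)) = lam ^ (1 - 2 * w) / (1 + lam ^ (1 - 2 * w)) := by
  have hu := zpow_pos h0 (1 - 2 * w)
  rw [show 2 * w - 1 = -(1 - 2 * w) by ring, zpow_neg]
  field_simp
  ring

theorem down_prob_le {lam : ℝ} (h0 : 0 < lam) (w : ℤ) :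
    1 / (1 + lam ^ (2 * w - 1)) ≤ lam ^ (1 - 2 * w) := by
  have hu := zpow_pos h0 (1 - 2 * w)
  rw [down_prob_eq h0]
  exact div_le_self hu.le (by linarith)

theorem half_le_down_prob {lam : ℝ} (h0 : 0 < lam) (h1 : lam < 1) {w : ℤ} (hw : w ≤ 0) :
    lam ^ (1 - 2 * w) / 2 ≤ 1 / (1 + lam ^ (2 * w - 1)) := by
  have hu := zpow_pos h0 (1 - 2 * w)
  have hu1 : lam ^ (1 - 2 * w) ≤ 1 := zpow_le_one₀ h0 h1.le (by omega)
  rw [down_prob_eq h0]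
  gcongr
  linarith

theorem up_prob_le {lam : ℝ} (h0 : 0 < lam) (w : ℤ) :
    1 - 1 / (1 + lam ^ (2 * w - 1)) ≤ lam ^ (2 * w - 1) := by
  have hu := zpow_pos h0 (2 * w - 1)
  rw [one_sub_div (by positivity), add_sub_cancel_left]
  exact div_le_self hu.le (by linarith)

theorem exp_neg_le_up_prob {lam : ℝ} (h0 : 0 < lam) (w : ℤ) :
    Real.exp (-lam ^ (1 - 2 * w)) ≤ 1 - 1 / (1 + lam ^ (2 * w - 1)) := by
  have hu := zpow_pos h0 (1 - 2 * w)
  rw [down_prob_eq h0, one_sub_div (by positivity), add_sub_cancel_right, Real.exp_neg,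
    ← one_div]
  gcongr
  linarith [Real.add_one_le_exp (lam ^ (1 - 2 * w))]

/-- The geometric series `∑_{v < w} lam ^ (1 - 2 * v)`. -/
def geomTail (lam : ℝ) (w : ℤ) : ℝ := lam ^ (3 - 2 * w) / (1 - lam ^ 2)

theorem one_sub_sq_pos {lam : ℝ} (h0 : 0 < lam) (h1 : lam < 1) : 0 < 1 - lam ^ 2 :=
  sub_pos.mpr (pow_lt_one₀ h0.le h1 two_ne_zero)

theorem geomTail_pos {lam : ℝ} (h0 : 0 < lam) (h1 : lam < 1) (w : ℤ) : 0 < geomTail lam w :=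
  div_pos (zpow_pos h0 _) (one_sub_sq_pos h0 h1)

theorem geomTail_eq {lam : ℝ} (h0 : 0 < lam) (w : ℤ) :
    geomTail lam w = lam ^ 2 / (1 - lam ^ 2) * lam ^ (1 - 2 * w) := by
  rw [geomTail, show 3 - 2 * w = 2 + (1 - 2 * w) by ring, zpow_add₀ h0.ne']
  norm_cast
  ring

theorem geomTail_succ {lam : ℝ} (h0 : 0 < lam) (h1 : lam < 1) (w : ℤ) :
    geomTail lam (w + 1) = geomTail lam w + lam ^ (1 - 2 * w) := by
  have := (one_sub_sq_pos h0 h1).ne'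
  rw [geomTail_eq h0 w, geomTail, show 3 - 2 * (w + 1) = 1 - 2 * w by ring]
  field_simp
  ring

theorem geomTail_le {lam : ℝ} (h0 : 0 < lam) (h1 : lam < 1) {w : ℤ} (hw : w ≤ 0) :
    geomTail lam w ≤ geomTail lam 0 := by
  have := one_sub_sq_pos h0 h1
  unfold geomTail
  gcongr ?_ / _
  exact zpow_le_zpow_right_of_le_one₀ h0 h1.le (by omega)

/-- The constant comparing the left tail with its last atom. -/
def leftTailConst (lam : ℝ) : ℝ :=
  2 * (lam ^ 2 / (1 - lam ^ 2)) / Real.exp (-geomTail lam 0)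

theorem leftTailConst_pos {lam : ℝ} (h0 : 0 < lam) (h1 : lam < 1) :
    0 < leftTailConst lam := by
  have := one_sub_sq_pos h0 h1
  unfold leftTailConst
  positivity

/-- The event `A` depends only on the coordinates up to time `j`. -/
def DependsOnPast (j : ℕ) (A : Set (ℕ → ℤ)) : Prop :=
  ∀ ω ω' : ℕ → ℤ, (∀ l ≤ j, ω l = ω' l) → ω ∈ A → ω' ∈ A

/-- The restriction of a path to the times `0, …, j`. -/
def pathPrefix (j : ℕ) (ω : ℕ → ℤ) : Fin (j + 1) → ℤ := fun l => ω l

theorem measurable_pathPrefix (j : ℕ) : Measurable (pathPrefix j) :=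
  measurable_pi_lambda _ fun _ => measurable_pi_apply _

theorem DependsOnPast.eq_preimage {j : ℕ} {A : Set (ℕ → ℤ)} (hA : DependsOnPast j A) :
    A = pathPrefix j ⁻¹' (pathPrefix j '' A) := by
  refine Set.Subset.antisymm (Set.subset_preimage_image _ _) ?_
  rintro ω ⟨ω', hω', h⟩
  refine hA ω' ω (fun l hl => ?_) hω'
  exact congrFun h ⟨l, Nat.lt_succ_of_le hl⟩

theorem DependsOnPast.measurableSet {j : ℕ} {A : Set (ℕ → ℤ)} (hA : DependsOnPast j A) :
    MeasurableSet A := by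
  rw [hA.eq_preimage]
  exact measurable_pathPrefix j (Set.to_countable _).measurableSet

theorem downCount_zero (ω : ℕ → ℤ) : downCount ω 0 = 0 := by simp [downCount]

theorem downCount_succ (ω : ℕ → ℤ) (j : ℕ) :
    downCount ω (j + 1) = downCount ω j + if ω (j + 1) = ω j - 1 then 1 else 0 := by
  unfold downCount
  rw [← Finset.insert_Icc_right_eq_Icc_add_one (by omega), Finset.filter_insert]
  split_ifs with h1 h2 h2
  · rw [Finset.card_insert_of_notMem (by simp)]
  · simp at h1; omega
  · simp at h1; omega
  · simp

theorem downCount_congr {ω ω' : ℕ → ℤ} {j : ℕ} (h : ∀ l ≤ j, ω l = ω' l) :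
    downCount ω j = downCount ω' j := by
  induction j with
  | zero => simp [downCount_zero]
  | succ j ih =>
    rw [downCount_succ, downCount_succ, ih fun l hl => h l (by omega), h _ le_rfl, h j (by omega)]

theorem downCount_mono (ω : ℕ → ℤ) : Monotone (downCount ω) :=
  monotone_nat_of_le_succ fun j => by rw [downCount_succ]; omega

theorem downCount_succ_le (ω : ℕ → ℤ) (j : ℕ) : downCount ω (j + 1) ≤ downCount ω j + 1 := by
  rw [downCount_succ]; split_ifs <;> omega

theorem exists_downCount_eq {ω : ℕ → ℤ} {j k : ℕ} (h : k ≤ downCount ω j) :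
    ∃ l ≤ j, downCount ω l = k := by
  induction j with
  | zero => exact ⟨0, le_rfl, by rw [downCount_zero] at *; omega⟩
  | succ j ih =>
    by_cases hk : k ≤ downCount ω j
    · obtain ⟨l, hl, h'⟩ := ih hk
      exact ⟨l, by omega, h'⟩
    · have := downCount_succ_le ω j
      exact ⟨j + 1, le_rfl, by omega⟩

/-- Either the path makes at least `k` down-steps, and `betaTime ω k` is the first time when the
number of down-steps reaches `k`, or it does not, and `betaTime ω k` has the junk value `0`. -/
theorem betaTime_spec (ω : ℕ → ℤ) {k : ℕ} (hk : 1 ≤ k) :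
    (downCount ω (betaTime ω k) = k ∧ ∀ j, k ≤ downCount ω j ↔ betaTime ω k ≤ j) ∨
      (betaTime ω k = 0 ∧ ∀ j, downCount ω j < k) := by
  by_cases h : {j | 1 ≤ j ∧ downCount ω j = k}.Nonempty
  · left
    have hm : 1 ≤ betaTime ω k ∧ downCount ω (betaTime ω k) = k := Nat.sInf_mem h
    refine ⟨hm.2, fun j => ⟨fun hj => ?_, fun hj => ?_⟩⟩
    · obtain ⟨l, hl, h'⟩ := exists_downCount_eq hj
      refine le_trans (Nat.sInf_le ⟨?_, h'⟩) hl
      rcases Nat.eq_zero_or_pos l with rfl | h0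
      · rw [downCount_zero] at h'; omega
      · exact h0
    · rw [← hm.2]; exact downCount_mono ω hj
  · right
    refine ⟨?_, fun j => ?_⟩
    · rw [betaTime, Set.not_nonempty_iff_eq_empty.mp h, Nat.sInf_empty]
    · by_contra! hj
      obtain ⟨l, hl, h'⟩ := exists_downCount_eq hj
      refine h ⟨l, ?_, h'⟩
      rcases Nat.eq_zero_or_pos l with rfl | h0
      · rw [downCount_zero] at h'; omega
      · exact h0

/-- The path `ω` starts at `i` and makes only unit steps. -/
def IsUnitPath (i : ℤ) (ω : ℕ → ℤ) : Prop :=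
  ω 0 = i ∧ ∀ j, ω (j + 1) = ω j + 1 ∨ ω (j + 1) = ω j - 1

theorem IsUnitPath.apply_eq {i : ℤ} {ω : ℕ → ℤ} (h : IsUnitPath i ω) (j : ℕ) :
    ω j = i + j - 2 * downCount ω j := by
  induction j with
  | zero => simp [downCount_zero, h.1]
  | succ j ih =>
    rw [downCount_succ]
    rcases h.2 j with h' | h' <;> rw [h']
    · rw [if_neg (by omega)]; push_cast; omega
    · rw [if_pos rfl]; push_cast; omega

theorem IsUnitPath.apply_betaTime_lt_iff {i : ℤ} {ω : ℕ → ℤ} (h : IsUnitPath i ω) {k s : ℕ}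
    (hk : 1 ≤ k) {w : ℤ} (hw : w ≤ i) (hs : (s : ℤ) + 1 = w - i + 2 * k) :
    ω (betaTime ω k) < w ↔ k ≤ downCount ω s := by
  rcases betaTime_spec ω hk with ⟨h1, h2⟩ | ⟨h1, h2⟩
  · rw [h2, h.apply_eq, h1]; omega
  · rw [h1, h.1]; have := h2 s; omega

theorem IsUnitPath.downCount_lt_of_le_apply_betaTime {i : ℤ} {ω : ℕ → ℤ} (h : IsUnitPath i ω)
    {k s : ℕ} (hk : 1 ≤ k) {w : ℤ} (hs : (s : ℤ) + 1 = w - i + 2 * k)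
    (hω : w ≤ ω (betaTime ω k)) : downCount ω s < k := by
  rcases betaTime_spec ω hk with ⟨h1, h2⟩ | ⟨h1, h2⟩
  · rw [← not_le, h2]; rw [h.apply_eq, h1] at hω; omega
  · exact h2 s

theorem IsUnitPath.le_apply_betaTime {i : ℤ} {ω : ℕ → ℤ} (h : IsUnitPath i ω) {k : ℕ}
    (hk : 1 ≤ k) : i - 2 * k ≤ ω (betaTime ω k) := by
  rcases betaTime_spec ω hk with ⟨h1, h2⟩ | ⟨h1, h2⟩
  · rw [h.apply_eq, h1]; omega
  · rw [h1, h.1]; omega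

theorem dependsOnPast_downCount {n k a s : ℕ} (hnk : n ≤ k) :
    DependsOnPast s {ω | n ≤ downCount ω a ∧ downCount ω s = k} := by
  rintro ω ω' h ⟨h1, h2⟩
  have h3 : downCount ω' s = k := by rw [← downCount_congr h, h2]
  refine ⟨?_, h3⟩
  rcases le_total a s with has | has
  · rw [← downCount_congr fun l hl => h l (hl.trans has)]; exact h1
  · have := downCount_mono ω' has; omega

theorem measurable_downCount (s : ℕ) : Measurable fun ω : ℕ → ℤ => downCount ω s := by
  refine measurable_to_countable' fun k => ?_
  have := (dependsOnPast_downCount (n := 0) (a := 0) (s := s) (Nat.zero_le k)).measurableSet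
  simpa [Set.preimage] using this

namespace IsUrnChain

variable {lam : ℝ} {P : ℤ → Measure (ℕ → ℤ)}

/-- The Markov property. -/
theorem measure_inter_step (hP : IsUrnChain lam P) (i y z : ℤ)
    {j : ℕ} {A : Set (ℕ → ℤ)} (hA : DependsOnPast j A) (hy : A ⊆ {ω | ω j = y}) :
    P i (A ∩ {ω | ω (j + 1) = z}) = P i A * ENNReal.ofReal (urnStep lam y z) := by
  have := hP.1 i
  have hcyl : ∀ (n : ℕ) (p : ℕ → ℤ), P i {ω | ∀ l ≤ n, ω l = p l} =
      ENNReal.ofReal ((if p 0 = i then (1 : ℝ) else 0) *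
          ∏ l ∈ Finset.range n, urnStep lam (p l) (p (l + 1))) := fun n p => by
    rw [← hP.2, ENNReal.ofReal_toReal (measure_ne_top _ _)]
  set S := pathPrefix j '' A with hS
  have hAS : A = ⋃ s ∈ S, pathPrefix j ⁻¹' {s} := by
    rw [Set.biUnion_preimage_singleton]; exact hA.eq_preimage
  have hAS' : A ∩ {ω | ω (j + 1) = z} =
      ⋃ s ∈ S, (pathPrefix j ⁻¹' {s} ∩ {ω | ω (j + 1) = z}) := by
    rw [← Set.iUnion₂_inter, ← hAS]
  have hmeas : ∀ s, MeasurableSet (pathPrefix j ⁻¹' {s}) := fun s =>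
    measurable_pathPrefix j (measurableSet_singleton s)
  have hdisj : S.PairwiseDisjoint fun s => pathPrefix j ⁻¹' {s} := fun s _ t _ hst =>
    Disjoint.preimage _ (Set.disjoint_singleton.mpr hst)
  have hz : MeasurableSet {ω : ℕ → ℤ | ω (j + 1) = z} :=
    (measurable_pi_apply (X := fun _ : ℕ => ℤ) (j + 1)) (measurableSet_singleton z)
  have e1 : P i A = ∑' s : S, P i (pathPrefix j ⁻¹' {s.1}) := by
    conv_lhs => rw [hAS]
    exact measure_biUnion (Set.to_countable S) hdisj fun s _ => hmeas s
  rw [hAS', measure_biUnion (Set.to_countable S)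
    (hdisj.mono fun s => Set.inter_subset_left) (fun s _ => (hmeas s).inter hz), e1,
    ← ENNReal.tsum_mul_right]
  refine tsum_congr fun ⟨s, ω₀, hω₀, hs⟩ => ?_
  set p : ℕ → ℤ := fun l => if l ≤ j then ω₀ l else z with hp
  have h1 : pathPrefix j ⁻¹' {s} = {ω | ∀ l ≤ j, ω l = p l} := by
    ext ω
    rw [← hs]
    simp only [Set.mem_preimage, Set.mem_singleton_iff, Set.mem_ofPred_eq]
    constructor
    · intro h l hl
      rw [hp]; simp only [if_pos hl]
      exact congrFun h ⟨l, Nat.lt_succ_of_le hl⟩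
    · intro h
      funext l
      have := h l (Nat.le_of_lt_succ l.2)
      rw [hp] at this
      simpa [pathPrefix, Nat.le_of_lt_succ l.2] using this
  have h2 : pathPrefix j ⁻¹' {s} ∩ {ω | ω (j + 1) = z} = {ω | ∀ l ≤ j + 1, ω l = p l} := by
    rw [h1]
    ext ω
    have hpz : p (j + 1) = z := by simp [hp]
    constructor
    · rintro ⟨h, h'⟩ l hl
      rcases Nat.le_succ_iff.mp hl with hl | rfl
      · exact h l hl
      · rw [hpz]; exact h'
    · intro h
      exact ⟨fun l hl => h l (by omega), by rw [← hpz]; exact h _ le_rfl⟩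
  have hpy : p j = y := by
    have : ω₀ j = y := hy hω₀
    simpa [hp] using this
  have hpz : p (j + 1) = z := by simp [hp]
  change P i (pathPrefix j ⁻¹' {s} ∩ _) = P i (pathPrefix j ⁻¹' {s}) * _
  rw [h2, h1, hcyl, hcyl, Finset.prod_range_succ, ← mul_assoc, hpy, hpz, ENNReal.ofReal_mul]
  rw [← hP.2]
  exact ENNReal.toReal_nonneg

theorem ae_isUnitPath (hP : IsUrnChain lam P) (i : ℤ) : ∀ᵐ ω ∂P i, IsUnitPath i ω := by
  have := hP.1 i
  refine Filter.Eventually.and ?_ (ae_all_iff.mpr fun j => ?_)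
  · have h := hP.2 i 0 fun _ => i
    simp only [Nat.le_zero, forall_eq, Finset.range_zero, Finset.prod_empty, if_true, mul_one] at h
    refine mem_ae_iff_prob_eq_one (measurable_pi_apply (X := fun _ : ℕ => ℤ) 0
      (measurableSet_singleton i)) |>.mpr ?_
    have h' : P i {ω | ω 0 = i} = 1 := by
      rw [← ENNReal.ofReal_toReal (measure_ne_top (P i) _), h, ENNReal.ofReal_one]
    exact h'
  · have h0 : ∀ y z : ℤ, ∀ᵐ ω ∂P i, ω j = y → ω (j + 1) = z → z = y + 1 ∨ z = y - 1 := by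
      intro y z
      by_cases hz : z = y + 1 ∨ z = y - 1
      · exact Filter.Eventually.of_forall fun _ _ _ => hz
      · have h := hP.measure_inter_step i y z (j := j) (A := {ω | ω j = y})
          (fun ω ω' h (hω : ω j = y) => by
            change ω' j = y
            rw [← h j le_rfl, hω]) subset_rfl
        push Not at hz
        rw [urnStep, if_neg hz.1, if_neg hz.2, ENNReal.ofReal_zero, mul_zero] at h
        rw [ae_iff]
        refine measure_mono_null (fun ω hω => ?_) h
        simp only [Set.mem_ofPred_eq, Classical.not_imp] at hω
        exact ⟨hω.1, hω.2.1⟩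
    filter_upwards [ae_all_iff.mpr fun y => ae_all_iff.mpr (h0 y)] with ω hω
    exact hω _ _ rfl rfl

/-- The probability of a down-step at time `s + 1`, after `k` down-steps up to time `s`. -/
theorem measureReal_downCount_step (hP : IsUrnChain lam P) (hlam : 0 < lam) (i : ℤ)
    {n k : ℕ} (hnk : n ≤ k) (a s : ℕ) :
    (P i).real {ω | n ≤ downCount ω a ∧ downCount ω s = k ∧ downCount ω (s + 1) = k + 1} =
      (P i).real {ω | n ≤ downCount ω a ∧ downCount ω s = k} *
        (1 / (1 + lam ^ (2 * (i + s - 2 * k) - 1))) := by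
  have := hP.1 i
  set y : ℤ := i + s - 2 * k with hy
  set A := {ω | n ≤ downCount ω a ∧ downCount ω s = k} ∩ {ω | ω s = y} with hA
  have hpast : DependsOnPast s A := fun ω ω' h hω =>
    ⟨dependsOnPast_downCount hnk ω ω' h hω.1, by
      change ω' s = y
      rw [← h s le_rfl]; exact hω.2⟩
  have h := hP.measure_inter_step i y (y - 1) hpast Set.inter_subset_right
  have h1 : P i {ω | n ≤ downCount ω a ∧ downCount ω s = k ∧ downCount ω (s + 1) = k + 1} =
      P i (A ∩ {ω | ω (s + 1) = y - 1}) := by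
    refine measure_congr ?_
    filter_upwards [hP.ae_isUnitPath i] with ω hω
    refine propext ?_
    change (_ ∧ _ ∧ _) ↔ (((_ ∧ _) ∧ ω s = y) ∧ ω (s + 1) = y - 1)
    have h2 := hω.apply_eq s
    have h3 := hω.apply_eq (s + 1)
    push_cast at h3
    omega
  have h2 : P i {ω | n ≤ downCount ω a ∧ downCount ω s = k} = P i A := by
    refine measure_congr ?_
    filter_upwards [hP.ae_isUnitPath i] with ω hω
    refine propext ?_
    change (_ ∧ _) ↔ ((_ ∧ _) ∧ ω s = y)
    have h2 := hω.apply_eq s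
    omega
  rw [Measure.real, Measure.real, h1, h2, h, ENNReal.toReal_mul, ENNReal.toReal_ofReal] <;>
    rw [urnStep, if_neg (by omega), if_pos rfl]
  have := zpow_pos hlam (2 * y - 1)
  positivity

theorem measureReal_downCount_lt_succ (hP : IsUrnChain lam P) (i : ℤ) (n k a s : ℕ) :
    (P i).real {ω | n ≤ downCount ω a ∧ downCount ω s < k + 1} =
      (P i).real {ω | n ≤ downCount ω a ∧ downCount ω s < k} +
        (P i).real {ω | n ≤ downCount ω a ∧ downCount ω s = k} := by
  have := hP.1 i
  rw [← measureReal_union]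
  · congr 1; ext ω; simp only [Set.mem_ofPred_eq, Set.mem_union]; omega
  · rw [Set.disjoint_left]; rintro ω ⟨_, h⟩ ⟨_, h'⟩; omega
  · exact (measurable_downCount a measurableSet_Ici).inter
      (measurable_downCount s (measurableSet_singleton k))

theorem measureReal_succ_downCount_lt_succ (hP : IsUrnChain lam P) (hlam : 0 < lam) (i : ℤ)
    {n k : ℕ} (hnk : n ≤ k) (a s : ℕ) :
    (P i).real {ω | n ≤ downCount ω a ∧ downCount ω (s + 1) < k + 1} =
      (P i).real {ω | n ≤ downCount ω a ∧ downCount ω s < k} +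
        (P i).real {ω | n ≤ downCount ω a ∧ downCount ω s = k} *
          (1 - 1 / (1 + lam ^ (2 * (i + s - 2 * k) - 1))) := by
  have := hP.1 i
  rw [mul_sub, mul_one, ← hP.measureReal_downCount_step hlam i hnk, ← add_sub_assoc,
    ← measureReal_downCount_lt_succ hP, eq_sub_iff_add_eq, ← measureReal_union]
  · congr 1
    ext ω
    have := downCount_succ_le ω s
    have := downCount_mono ω s.le_succ
    simp only [Set.mem_ofPred_eq, Set.mem_union, Nat.succ_eq_add_one] at *
    omega
  · rw [Set.disjoint_left]; rintro ω ⟨_, h⟩ ⟨_, _, h'⟩; omega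
  · exact (measurable_downCount a measurableSet_Ici).inter
      ((measurable_downCount s (measurableSet_singleton k)).inter
        (measurable_downCount (s + 1) (measurableSet_singleton (k + 1))))

/-- From any starting point, the position before the next down-step is at least a given
nonpositive level with probability bounded below. -/
theorem le_measureReal_downCount_lt_succ (hP : IsUrnChain lam P) (h0 : 0 < lam) (h1 : lam < 1)
    (i : ℤ) {n k : ℕ} (hnk : n ≤ k) (a : ℕ) {s : ℕ} (hs : i + s - 2 * k ≤ 0) :
    Real.exp (-geomTail lam 0) * (P i).real {ω | n ≤ downCount ω a} ≤
      (P i).real {ω | n ≤ downCount ω a ∧ downCount ω s < k + 1} := by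
  have := hP.1 i
  have key : ∀ s : ℕ, Real.exp (-geomTail lam (i + s - 2 * k)) *
      (P i).real {ω | n ≤ downCount ω a} ≤
        (P i).real {ω | n ≤ downCount ω a ∧ downCount ω s < k + 1} := by
    intro s
    induction s with
    | zero =>
      simp only [downCount_zero, Nat.succ_pos, and_true]
      refine mul_le_of_le_one_left measureReal_nonneg (Real.exp_le_one_iff.mpr ?_)
      linarith [geomTail_pos h0 h1 (i + (0 : ℕ) - 2 * k)]
    | succ s ih =>
      rw [hP.measureReal_succ_downCount_lt_succ h0 i hnk,
        show i + (s + 1 : ℕ) - 2 * (k : ℤ) = i + s - 2 * k + 1 by push_cast; ring,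
        geomTail_succ h0 h1, neg_add, Real.exp_add]
      rw [hP.measureReal_downCount_lt_succ] at ih
      set w : ℤ := i + s - 2 * k
      have hp := exp_neg_le_up_prob h0 w
      have hp1 : 1 - 1 / (1 + lam ^ (2 * w - 1)) ≤ 1 := by
        have := zpow_pos h0 (2 * w - 1)
        linarith [show 0 ≤ 1 / (1 + lam ^ (2 * w - 1)) by positivity]
      set p := 1 - 1 / (1 + lam ^ (2 * w - 1))
      have hX : 0 ≤ (P i).real {ω | n ≤ downCount ω a ∧ downCount ω s < k} := measureReal_nonneg
      have hY : 0 ≤ (P i).real {ω | n ≤ downCount ω a ∧ downCount ω s = k} := measureReal_nonneg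
      have hp0 : 0 ≤ p := (Real.exp_pos _).le.trans hp
      calc _ = Real.exp (-lam ^ (1 - 2 * w)) *
            (Real.exp (-geomTail lam w) * (P i).real {ω | n ≤ downCount ω a}) := by ring
        _ ≤ p * (_ + _) := by gcongr
        _ ≤ _ := by nlinarith
  refine le_trans ?_ (key s)
  gcongr
  exact geomTail_le h0 h1 hs

/-- Gaussian-type bound for the right tail, uniform in the number of down-steps. -/
theorem measureReal_downCount_lt_le (hP : IsUrnChain lam P) (h0 : 0 < lam) (h1 : lam < 1)
    (i : ℤ) {n k : ℕ} (hnk : n ≤ k) {a s : ℕ} {w : ℤ} (hs : (s : ℤ) + 1 = w - i + 2 * k)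
    (hw : (a : ℤ) + 1 ≤ w - i + 2 * n) :
    (P i).real {ω | n ≤ downCount ω a ∧ downCount ω s < k} ≤
      lam ^ (2 * w - 1) / (1 - lam ^ 2) * (P i).real {ω | n ≤ downCount ω a} := by
  have := hP.1 i
  have hpos := one_sub_sq_pos h0 h1
  induction k, hnk using Nat.le_induction generalizing s w with
  | base =>
    have has : a ≤ s := by omega
    have : {ω : ℕ → ℤ | n ≤ downCount ω a ∧ downCount ω s < n} = ∅ := by
      ext ω
      have := downCount_mono ω has
      simp only [Set.mem_ofPred_eq, Set.mem_empty_iff_false, iff_false]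
      omega
    rw [this, measureReal_empty]
    have := zpow_pos h0 (2 * w - 1)
    positivity
  | succ k hnk ih =>
    obtain ⟨s, rfl⟩ : ∃ t, s = t + 1 := ⟨s - 1, by omega⟩
    push_cast at hs
    rw [hP.measureReal_succ_downCount_lt_succ h0 i hnk,
      show i + (s : ℤ) - 2 * k = w by omega]
    have h := ih (s := s) (w := w + 1) (by omega) (by omega)
    have h2 : (P i).real {ω | n ≤ downCount ω a ∧ downCount ω s = k} ≤
        (P i).real {ω | n ≤ downCount ω a} := measureReal_mono fun ω hω => hω.1
    have h3 := up_prob_le h0 w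
    have hz := zpow_pos h0 (2 * w - 1)
    calc _ ≤ lam ^ (2 * (w + 1) - 1) / (1 - lam ^ 2) * (P i).real {ω | n ≤ downCount ω a} +
          (P i).real {ω | n ≤ downCount ω a} * lam ^ (2 * w - 1) :=
          add_le_add h ((mul_le_mul_of_nonneg_left h3 measureReal_nonneg).trans
            (mul_le_mul_of_nonneg_right h2 hz.le))
      _ = _ := by
        rw [show 2 * (w + 1) - 1 = 2 + (2 * w - 1) by ring, zpow_add₀ h0.ne']
        norm_cast
        field_simp
        ring

/-- The left tail decays at each step by a fixed factor. -/
theorem measureReal_left_tail_step (hP : IsUrnChain lam P) (h0 : 0 < lam) (h1 : lam < 1)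
    (i : ℤ) {n s : ℕ} (hn : 1 ≤ n) (hs : i + s + 2 ≤ 2 * n) :
    (P i).real {ω | n ≤ downCount ω s} ≤ leftTailConst lam / (1 + leftTailConst lam) *
      (P i).real {ω | n ≤ downCount ω (s + 1)} := by
  have := hP.1 i
  have hK := leftTailConst_pos h0 h1
  rcases s with _ | t
  · have : {ω : ℕ → ℤ | n ≤ downCount ω 0} = ∅ := by
      ext ω
      simp only [downCount_zero, Set.mem_ofPred_eq, Set.mem_empty_iff_false, iff_false]
      omega
    rw [this, measureReal_empty]
    positivity
  obtain ⟨k, rfl⟩ : ∃ k, n = k + 1 := ⟨n - 1, by omega⟩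
  set E := (P i).real {ω | k ≤ downCount ω t} with hE
  have hE0 : 0 ≤ E := measureReal_nonneg
  have hupper : ∀ l ≤ t + 1, (P i).real {ω | k + 1 ≤ downCount ω l} ≤
      geomTail lam (i + l - 2 * k) * E := by
    intro l
    induction l with
    | zero =>
      intro _
      have hemp : {ω : ℕ → ℤ | k + 1 ≤ downCount ω 0} = ∅ := by
        ext ω; simp [downCount_zero]
      rw [hemp, measureReal_empty]
      exact mul_nonneg (geomTail_pos h0 h1 _).le hE0
    | succ l ih =>
      intro hl
      rw [show i + (l + 1 : ℕ) - 2 * (k : ℤ) = i + l - 2 * k + 1 by push_cast; ring,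
        geomTail_succ h0 h1, add_mul]
      have hsub : {ω : ℕ → ℤ | k + 1 ≤ downCount ω (l + 1)} ⊆ {ω | k + 1 ≤ downCount ω l} ∪
          {ω | k ≤ downCount ω l ∧ downCount ω l = k ∧ downCount ω (l + 1) = k + 1} := by
        intro ω hω
        have := downCount_succ_le ω l
        simp only [Set.mem_ofPred_eq, Set.mem_union] at *
        omega
      have hEl : (P i).real {ω | k ≤ downCount ω l ∧ downCount ω l = k} ≤ E :=
        measureReal_mono fun ω hω => hω.1.trans (downCount_mono ω (by omega))
      refine (measureReal_mono hsub).trans ((measureReal_union_le _ _).trans ?_)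
      rw [hP.measureReal_downCount_step h0 i le_rfl, mul_comm _ (1 / _)]
      have hq := down_prob_le h0 (i + l - 2 * k)
      have hz := zpow_pos h0 (1 - 2 * (i + l - 2 * k))
      exact add_le_add (ih (by omega)) (mul_le_mul hq hEl measureReal_nonneg hz.le)
  set w : ℤ := i + (t + 1 : ℕ) - 2 * k with hw
  have hw0 : w ≤ 0 := by push_cast at *; omega
  set D := (P i).real
    {ω | k ≤ downCount ω t ∧ downCount ω (t + 1) = k ∧ downCount ω (t + 1 + 1) = k + 1} with hD
  have hlower : lam ^ (1 - 2 * w) / 2 * (Real.exp (-geomTail lam 0) * E) ≤ D := by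
    rw [hD, hP.measureReal_downCount_step h0 i le_rfl, mul_comm _ (1 / _)]
    have h2 := hP.le_measureReal_downCount_lt_succ h0 h1 i (le_refl k) t hw0
    have h3 : (P i).real {ω | k ≤ downCount ω t ∧ downCount ω (t + 1) < k + 1} ≤
        (P i).real {ω | k ≤ downCount ω t ∧ downCount ω (t + 1) = k} :=
      measureReal_mono fun ω hω => by
        have := downCount_mono ω t.le_succ
        simp only [Set.mem_ofPred_eq, Nat.succ_eq_add_one] at *
        omega
    exact mul_le_mul (half_le_down_prob h0 h1 hw0) (h2.trans h3) (by positivity) (by positivity)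
  have hsum : (P i).real {ω | k + 1 ≤ downCount ω (t + 1)} + D ≤
      (P i).real {ω | k + 1 ≤ downCount ω (t + 1 + 1)} := by
    rw [hD, ← measureReal_union]
    · refine measureReal_mono fun ω hω => ?_
      have := downCount_mono ω (t + 1).le_succ
      simp only [Set.mem_ofPred_eq, Set.mem_union, Nat.succ_eq_add_one] at *
      omega
    · rw [Set.disjoint_left]
      rintro ω h ⟨_, h', _⟩
      simp only [Set.mem_ofPred_eq] at h
      omega
    · exact (measurable_downCount t measurableSet_Ici).inter
        ((measurable_downCount _ (measurableSet_singleton k)).inter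
          (measurable_downCount _ (measurableSet_singleton (k + 1))))
  have hX := hupper (t + 1) le_rfl
  rw [geomTail_eq h0, ← hw] at hX
  have hXD : (P i).real {ω | k + 1 ≤ downCount ω (t + 1)} ≤ leftTailConst lam * D := by
    refine hX.trans (le_trans (le_of_eq ?_) (mul_le_mul_of_nonneg_left hlower hK.le))
    have := Real.exp_pos (-geomTail lam 0)
    rw [leftTailConst]
    field_simp
  rw [div_mul_eq_mul_div, le_div_iff₀ (by positivity)]
  nlinarith

theorem measureReal_left_tail_le (hP : IsUrnChain lam P) (h0 : 0 < lam) (h1 : lam < 1)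
    (i : ℤ) {n s h : ℕ} (hn : 1 ≤ n) (hs : i + s + h + 1 ≤ 2 * n) :
    (P i).real {ω | n ≤ downCount ω s} ≤ (leftTailConst lam / (1 + leftTailConst lam)) ^ h *
      (P i).real {ω | n ≤ downCount ω (s + h)} := by
  have hK := leftTailConst_pos h0 h1
  induction h with
  | zero => simp
  | succ h ih =>
    push_cast at hs
    refine (ih (by omega)).trans ?_
    rw [pow_succ, mul_assoc]
    gcongr
    exact hP.measureReal_left_tail_step h0 h1 i hn (by push_cast; omega)

end IsUrnChain

/-- Geometric decay in `x / 2` is bounded by exponential decay in `x`. -/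
theorem pow_half_le_exp {ρ : ℝ} (h0 : 0 < ρ) (h1 : ρ < 1) (x : ℕ) :
    ρ ^ (x / 2) ≤ ρ⁻¹ * Real.exp (-(-Real.log ρ / 2) * x) := by
  have hlog := Real.log_neg h0 h1
  have hx : (x : ℝ) ≤ 2 * (x / 2 : ℕ) + 1 := by exact_mod_cast (by omega : x ≤ 2 * (x / 2) + 1)
  rw [← Real.rpow_natCast, Real.rpow_def_of_pos h0, ← Real.exp_log (inv_pos.mpr h0),
    ← Real.exp_add, Real.log_inv, Real.exp_le_exp]
  nlinarith

/-- Exponential overshoot bound for the increment `𝔇_{β_{n+m}} - 𝔇_{β_n}` on the event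
`𝔇_{β_n} < -b`. -/
theorem urn_increment_overshoot_low (lam : ℝ) (hlam : lam ∈ Set.Ioo (0 : ℝ) 1)
    (P : ℤ → Measure (ℕ → ℤ)) (hP : IsUrnChain lam P) :
    ∃ C > (0 : ℝ), ∃ c > (0 : ℝ),
      ∀ (b n m x : ℕ), 1 ≤ b → 1 ≤ n → 1 ≤ m → 1 ≤ x → ∀ i : ℤ, i = 0 ∨ i = 1 →
        (P i {ω | (b : ℤ) + (x : ℤ) ≤
              ω (betaTime ω (n + m)) - ω (betaTime ω n) ∧
            ω (betaTime ω n) < -(b : ℤ)}).toReal ≤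
          C * Real.exp (-c * (x : ℝ)) *
            (P i {ω | (b : ℤ) ≤ ω (betaTime ω (n + m)) - ω (betaTime ω n) ∧
              ω (betaTime ω n) < -(b : ℤ)}).toReal := by
  obtain ⟨h0, h1⟩ := hlam
  have hK := leftTailConst_pos h0 h1
  have hsq := one_sub_sq_pos h0 h1
  set r := leftTailConst lam / (1 + leftTailConst lam) with hr
  have hr0 : 0 < r := by positivity
  have hr1 : r < 1 := by rw [hr, div_lt_one (by positivity)]; linarith
  set ρ := max r (lam ^ 2) with hρ
  have hρ0 : 0 < ρ := lt_max_of_lt_left hr0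
  have hρ1 : ρ < 1 := max_lt hr1 (by linarith)
  set K := lam⁻¹ / (1 - lam ^ 2) with hKdef
  have hKpos : 0 < K := by positivity
  set c₀ := Real.exp (-geomTail lam 0) with hc₀
  have hc₀pos : 0 < c₀ := Real.exp_pos _
  refine ⟨(1 + K) * ρ⁻¹ * c₀⁻¹, by positivity, -Real.log ρ / 2,
    by linarith [Real.log_neg hρ0 hρ1], ?_⟩
  intro b n m x hb hn hm hx i hi
  have hi0 : 0 ≤ i ∧ i ≤ 1 := by omega
  have := hP.1 i
  change (P i).real _ ≤ _ * (P i).real _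
  by_cases ha : i + b + 1 ≤ 2 * n
  swap
  · have hnull : (P i).real {ω | (b : ℤ) + (x : ℤ) ≤
        ω (betaTime ω (n + m)) - ω (betaTime ω n) ∧ ω (betaTime ω n) < -(b : ℤ)} = 0 := by
      rw [measureReal_eq_zero_iff]
      refine measure_mono_null (fun ω hω => ?_) (ae_iff.mp (hP.ae_isUnitPath i))
      intro (hpath : IsUnitPath i ω)
      have := IsUnitPath.le_apply_betaTime hpath hn
      have := hω.2
      omega
    rw [hnull]
    positivity
  obtain ⟨a, ha'⟩ : ∃ a : ℕ, (a : ℤ) + 1 = -(b : ℤ) - i + 2 * n :=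
    ⟨(-(b : ℤ) - i + 2 * n - 1).toNat, by omega⟩
  set E := (P i).real {ω | n ≤ downCount ω a} with hE
  have hE0 : 0 ≤ E := measureReal_nonneg
  have hlower : c₀ * E ≤ (P i).real {ω | (b : ℤ) ≤ ω (betaTime ω (n + m)) - ω (betaTime ω n) ∧
      ω (betaTime ω n) < -(b : ℤ)} := by
    obtain ⟨s, hs⟩ : ∃ s : ℕ, (s : ℤ) + 1 = -1 - i + 2 * (n + m : ℕ) :=
      ⟨(-1 - i + 2 * (n + m : ℕ) - 1).toNat, by omega⟩
    have h := hP.le_measureReal_downCount_lt_succ h0 h1 i (n := n) (k := n + m - 1)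
      (by omega) a (s := s) (by omega)
    refine h.trans ?_
    rw [Measure.real, Measure.real]
    refine ENNReal.toReal_mono (measure_ne_top _ _) (measure_mono_ae ?_)
    filter_upwards [hP.ae_isUnitPath i] with ω hpath
    rintro ⟨hω1, hω2⟩
    have e1 := (hpath.apply_betaTime_lt_iff hn (w := -b) (by omega) ha').mpr hω1
    have e2 := hpath.apply_betaTime_lt_iff (k := n + m) (by omega) (w := -1) (by omega) hs
    refine ⟨?_, e1⟩
    omega
  set h := x / 2 with hh
  have hupper : (P i).real {ω | (b : ℤ) + (x : ℤ) ≤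
        ω (betaTime ω (n + m)) - ω (betaTime ω n) ∧ ω (betaTime ω n) < -(b : ℤ)} ≤
      ρ ^ h * E + K * ρ ^ h * E := by
    obtain ⟨s, hs⟩ : ∃ s : ℕ, (s : ℤ) + 1 = h - i + 2 * (n + m : ℕ) :=
      ⟨((h : ℤ) - i + 2 * (n + m : ℕ) - 1).toNat, by omega⟩
    have hfar : (P i).real {ω | ω (betaTime ω n) < -(b : ℤ) - h} ≤ ρ ^ h * E := by
      by_cases hah : h ≤ a
      · obtain ⟨t, rfl⟩ : ∃ t, a = t + h := ⟨a - h, by omega⟩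
        have h2 := hP.measureReal_left_tail_le h0 h1 i (s := t) (h := h) hn
          (by push_cast at ha'; omega)
        have h3 : (P i).real {ω | ω (betaTime ω n) < -(b : ℤ) - h} ≤
            (P i).real {ω | n ≤ downCount ω t} := by
          refine ENNReal.toReal_mono (measure_ne_top _ _) (measure_mono_ae ?_)
          filter_upwards [hP.ae_isUnitPath i] with ω hpath
          exact (hpath.apply_betaTime_lt_iff hn (by omega) (by push_cast at ha'; omega)).mp
        refine h3.trans (h2.trans ?_)
        gcongr
        exact le_max_left _ _
      · have hnull : (P i).real {ω | ω (betaTime ω n) < -(b : ℤ) - h} = 0 := by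
          rw [measureReal_eq_zero_iff]
          refine measure_mono_null (fun ω hω => ?_) (ae_iff.mp (hP.ae_isUnitPath i))
          intro (hpath : IsUnitPath i ω)
          have := IsUnitPath.le_apply_betaTime hpath hn
          change ω (betaTime ω n) < -(b : ℤ) - h at hω
          omega
        rw [hnull]
        positivity
    have hnear : (P i).real {ω | n ≤ downCount ω a ∧ downCount ω s < n + m} ≤
        K * ρ ^ h * E := by
      refine (hP.measureReal_downCount_lt_le h0 h1 i (by omega) hs (by omega)).trans ?_
      gcongr
      have hpow : lam ^ (2 * (h : ℤ) - 1) = lam⁻¹ * (lam ^ 2) ^ h := by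
        rw [← pow_mul, zpow_sub₀ h0.ne', zpow_one, div_eq_inv_mul]
        norm_cast
      rw [hpow, mul_div_right_comm]
      gcongr
      exact le_max_right _ _
    refine le_trans ?_ (add_le_add hfar hnear)
    refine le_trans ?_ (measureReal_union_le _ _)
    refine ENNReal.toReal_mono (measure_ne_top _ _) (measure_mono_ae ?_)
    filter_upwards [hP.ae_isUnitPath i] with ω hpath
    rintro ⟨hω1, hω2⟩
    by_cases hfar' : ω (betaTime ω n) < -(b : ℤ) - h
    · exact Or.inl hfar'
    · refine Or.inr ⟨(hpath.apply_betaTime_lt_iff hn (by omega) ha').mp hω2,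
        hpath.downCount_lt_of_le_apply_betaTime (by omega) hs (by omega)⟩
  refine hupper.trans ?_
  have hexp := pow_half_le_exp hρ0 hρ1 x
  set e := Real.exp (-(-Real.log ρ / 2) * x)
  have he : 0 < e := Real.exp_pos _
  calc ρ ^ h * E + K * ρ ^ h * E = (1 + K) * ρ ^ h * E := by ring
    _ ≤ (1 + K) * (ρ⁻¹ * e) * E := by gcongr
    _ = (1 + K) * ρ⁻¹ * c₀⁻¹ * e * (c₀ * E) := by field_simp
    _ ≤ _ := by gcongr
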